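/- There exists D₀ ∈ ℕ, depending only on B and w₁, …, w_r, with the following property: if f ∈ C¹ is supported on a finite nonempty subtree X₁ of T and also supported on a finite nonempty subtree X₂ of T, and X₁ ∩ X₂ ≠ ∅, then f is supported on the ball of radius D₀ about the subtree X₁ ∩ X₂. -/

import Mathlib

open scoped BigOperators

namespace DecompPaper

variable (B : Type) [DecidableEq B]

/-- The set of letters `B ⊔ B⁻¹` carries the discrete topology. -/
instance : TopologicalSpace (B × Bool) := ⊥

/-- The Gromov boundary `∂F` of the free group on `B`: the space of infinite reduced
words, i.e. sequences of letters with no cancelling adjacent pair, topologized as a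
subspace of the product of discrete spaces. -/
abbrev Boundary : Type :=
  {s : ℕ → B × Bool // ∀ k, s (k + 1) ≠ ((s k).1, !(s k).2)}

/-- The prefix of length `m` of an infinite reduced word, as an element of the free group. -/
def prefixOf (ξ : Boundary B) (m : ℕ) : FreeGroup B :=
  FreeGroup.mk (List.ofFn fun i : Fin m => ξ.1 i)

/-- Adjacency in the Cayley graph `T` of the free group with respect to `B`. -/
def Adj (g h : FreeGroup B) : Prop :=
  ∃ x : B × Bool, h = g * FreeGroup.mk [x]

/-- A set of vertices of `T` is a subtree iff any two of its vertices are joined by a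
path in the Cayley graph staying inside the set. -/
def IsSubtree (X : Set (FreeGroup B)) : Prop :=
  ∀ g ∈ X, ∀ h ∈ X, Relation.ReflTransGen (fun a b => Adj B a b ∧ b ∈ X) g h

/-- `C` is a connected component of `T ∖ X`. -/
def IsComponentOf (X C : Set (FreeGroup B)) : Prop :=
  ∃ v, v ∉ X ∧
    C = {u | Relation.ReflTransGen (fun a b => Adj B a b ∧ a ∉ X ∧ b ∉ X) v u}

/-- `∂C`: the set of boundary points all of whose sufficiently long prefixes lie in `C`. -/
def boundaryOf (C : Set (FreeGroup B)) : Set (Boundary B) :=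
  {ξ | ∃ m, ∀ k, m ≤ k → prefixOf B ξ k ∈ C}

/-- The sequence `a` of group elements converges to the boundary point `ξ`:
every prefix of `ξ` is eventually an initial segment of the reduced word of `a k`. -/
def TendstoBoundary (a : ℕ → FreeGroup B) (ξ : Boundary B) : Prop :=
  ∀ m : ℕ, ∃ K, ∀ k, K ≤ k → (List.ofFn fun i : Fin m => ξ.1 i) <+: (a k).toWord

/-- `{ξ, η}` is a line of the line pattern generated by the words `w i`: for some
`g` and `i`, `ξ` and `η` are the limits of `g * (w i) ^ k` as `k → +∞` and `k → -∞`
(in one of the two orders). -/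
def IsLine {r : ℕ} (w : Fin r → FreeGroup B) (ξ η : Boundary B) : Prop :=
  ∃ (g : FreeGroup B) (i : Fin r),
    (TendstoBoundary B (fun k => g * w i ^ k) ξ ∧
       TendstoBoundary B (fun k => g * (w i)⁻¹ ^ k) η) ∨
    (TendstoBoundary B (fun k => g * w i ^ k) η ∧
       TendstoBoundary B (fun k => g * (w i)⁻¹ ^ k) ξ)

/-- Malnormality of the family of cyclic subgroups `⟨w i⟩`. -/
def Malnormal {r : ℕ} (w : Fin r → FreeGroup B) : Prop :=
  ∀ (g : FreeGroup B) (i j : Fin r),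
    (∃ x : FreeGroup B, x ∈ Subgroup.zpowers (w i) ∧ x ≠ 1 ∧
        g * x * g⁻¹ ∈ Subgroup.zpowers (w j)) →
      i = j ∧ g ∈ Subgroup.zpowers (w i)

/-- The decomposition space `D`: the quotient of `∂F` by the smallest equivalence
relation identifying the two endpoints of each line, with the quotient topology. -/
abbrev DSpace {r : ℕ} (w : Fin r → FreeGroup B) : Type :=
  Quot (IsLine B w)

/-- The quotient projection `q : ∂F → D`. -/
def qmap {r : ℕ} (w : Fin r → FreeGroup B) : Boundary B → DSpace B w :=
  Quot.mk _

/-- The geodesic of the line with endpoints `ξ` and `η`: all prefixes of `ξ` or of `η`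
of length at least the length of their longest common initial segment. -/
def lineGeodesic (ξ η : Boundary B) : Set (FreeGroup B) :=
  {g | ∃ k : ℕ, (g = prefixOf B ξ k ∨ g = prefixOf B η k) ∧ ∃ i ≤ k, ξ.1 i ≠ η.1 i}

/-- The line with endpoints `ξ, η` passes through the subtree `X`. -/
def PassesThrough (ξ η : Boundary B) (X : Set (FreeGroup B)) : Prop :=
  ∃ g ∈ X, g ∈ lineGeodesic B ξ η

/-- A function `σ : D → ℤ` is supported on the subtree `X` if `σ ∘ q` is constant on
`∂C` for every connected component `C` of `T ∖ X`. -/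
def SupportedOn {r : ℕ} (w : Fin r → FreeGroup B) (σ : DSpace B w → ℤ)
    (X : Set (FreeGroup B)) : Prop :=
  ∀ C : Set (FreeGroup B), IsComponentOf B X C →
    ∀ ξ, ξ ∈ boundaryOf B C → ∀ η, η ∈ boundaryOf B C →
      σ (qmap B w ξ) = σ (qmap B w η)

/-- Prepending a letter to an infinite reduced word, cancelling if necessary. -/
def consB (x : B × Bool) (ξ : Boundary B) : Boundary B :=
  if h : ξ.1 0 = (x.1, !x.2) then
    ⟨fun k => ξ.1 (k + 1), fun k => ξ.2 (k + 1)⟩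
  else
    ⟨fun k => Nat.rec x (fun j _ => ξ.1 j) k, by
      intro k
      cases k with
      | zero => exact h
      | succ j => exact ξ.2 j⟩

/-- The action of the free group on its boundary: left multiplication followed by
reduction. -/
def actB (g : FreeGroup B) (ξ : Boundary B) : Boundary B :=
  g.toWord.foldr (consB B) ξ

/-- The induced action of the free group on the decomposition space. -/
noncomputable def actD {r : ℕ} (w : Fin r → FreeGroup B) (g : FreeGroup B)
    (x : DSpace B w) : DSpace B w :=
  qmap B w (actB B g (Quot.out x))

/-- The map `p : (ℤ[F])^k → C(D, ℤ)` of right `ℤ[F]`-modules determined by generators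
`σ j`, where an element of the free module `(ℤ[F])^k` is recorded as a finitely
supported function `(Fin k × F) →₀ ℤ` and `e_j · g` is sent to `σ j · g`. -/
noncomputable def pMap {r : ℕ} (w : Fin r → FreeGroup B) {k : ℕ}
    (σ : Fin k → DSpace B w → ℤ) (x : (Fin k × FreeGroup B) →₀ ℤ) :
    DSpace B w → ℤ :=
  fun d => x.sum fun p n => n * σ p.1 (actD B w p.2 d)

/-- Right translation by `g` on the free module `(ℤ[F])^k`, sending `e_j · h` to
`e_j · (h * g)`. -/
noncomputable def fsTranslate {k : ℕ} (y : (Fin k × FreeGroup B) →₀ ℤ)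
    (g : FreeGroup B) : (Fin k × FreeGroup B) →₀ ℤ :=
  Finsupp.mapDomain (fun p => (p.1, p.2 * g)) y

/-- The convex hull of a set of vertices of `T`: the smallest subtree containing it. -/
def hull (S : Set (FreeGroup B)) : Set (FreeGroup B) :=
  ⋂₀ {Y : Set (FreeGroup B) | IsSubtree B Y ∧ S ⊆ Y}

/-- The support of an element of the free module `(ℤ[F])^k`, relative to supports
`X j` of the generators: the convex hull of the union of the sets `g⁻¹ • X j` over
the pairs `(j, g)` appearing with nonzero coefficient. -/
def fsSupport {k : ℕ} (X : Fin k → Set (FreeGroup B))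
    (x : (Fin k × FreeGroup B) →₀ ℤ) : Set (FreeGroup B) :=
  hull B (⋃ p ∈ x.support, (fun v => p.2⁻¹ * v) '' X p.1)

/-- Antisymmetry of a `1`-cochain on oriented lines. -/
def Antisym {r : ℕ} (w : Fin r → FreeGroup B)
    (f : Boundary B → Boundary B → ℤ) : Prop :=
  ∀ ξ η, IsLine B w ξ η → f η ξ = -f ξ η

/-- A `1`-cochain is supported on the subtree `X`: it vanishes on lines not passing
through `X`, and depends only on the pair of components of `T ∖ X` containing the two
endpoints. -/
def SupportedOn1 {r : ℕ} (w : Fin r → FreeGroup B)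
    (f : Boundary B → Boundary B → ℤ) (X : Set (FreeGroup B)) : Prop :=
  (∀ ξ η, IsLine B w ξ η → ¬PassesThrough B ξ η X → f ξ η = 0) ∧
  (∀ C C' : Set (FreeGroup B), IsComponentOf B X C → IsComponentOf B X C' → C ≠ C' →
    ∀ ξ ξ' η η', IsLine B w ξ η → IsLine B w ξ' η' →
      ξ ∈ boundaryOf B C → ξ' ∈ boundaryOf B C →
      η ∈ boundaryOf B C' → η' ∈ boundaryOf B C' →
      f ξ η = f ξ' η')

/-- Membership in `C¹`: an antisymmetric integer-valued function on oriented lines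
supported on at least one finite nonempty subtree of `T`. -/
def MemC1 {r : ℕ} (w : Fin r → FreeGroup B)
    (f : Boundary B → Boundary B → ℤ) : Prop :=
  Antisym B w f ∧
    ∃ X : Set (FreeGroup B), X.Finite ∧ X.Nonempty ∧ IsSubtree B X ∧
      SupportedOn1 B w f X

/-- The ball of radius `R` about a set `Y` of vertices of `T` (word metric). -/
def ballAbout (Y : Set (FreeGroup B)) (R : ℕ) : Set (FreeGroup B) :=
  {g | ∃ y ∈ Y, (y⁻¹ * g).toWord.length ≤ R}

/-- The map `p : (ℤ[F])^k → C¹` of right `ℤ[F]`-modules determined by generators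
`f j`, sending `e_j · g` to `f j · g`. -/
noncomputable def pC1 {k : ℕ} (f : Fin k → Boundary B → Boundary B → ℤ)
    (x : (Fin k × FreeGroup B) →₀ ℤ) : Boundary B → Boundary B → ℤ :=
  fun ξ η => x.sum fun p n => n * f p.1 (actB B p.2 ξ) (actB B p.2 η)

/-- `σ : ∂F → ℤ` is constant on `∂C` for every connected component `C` of `T ∖ X`. -/
def ConstOnComponents (X : Set (FreeGroup B)) (σ : Boundary B → ℤ) : Prop :=
  ∀ C : Set (FreeGroup B), IsComponentOf B X C →
    ∀ ξ, ξ ∈ boundaryOf B C → ∀ η, η ∈ boundaryOf B C → σ ξ = σ η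

/-- The shadow `S(g) ⊆ ∂F` of a nontrivial group element `g`: the boundary points
having the reduced word of `g` as an initial segment. -/
def shadow (g : FreeGroup B) : Set (Boundary B) :=
  {ξ | prefixOf B ξ g.toWord.length = g}

end DecompPaper

open DecompPaper

namespace DecompPaper

open FreeGroup

variable {B : Type}

theorem exists_common_prefix {α : Type*} (L M : List α) : ∃ p L' M', L = p ++ L' ∧ M = p ++ M' ∧
    (L'.head? = M'.head? → L' = []) := by
  induction L generalizing M with
  | nil => exact ⟨[], [], M, rfl, rfl, fun _ => rfl⟩
  | cons a L ih =>
    by_cases h : (a :: L).head? = M.head?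
    · cases M with
      | nil => simp at h
      | cons b M =>
        obtain rfl : a = b := by simpa using h
        obtain ⟨p, L', M', rfl, rfl, hLM⟩ := ih M
        exact ⟨a :: p, L', M', rfl, rfl, hLM⟩
    · exact ⟨[], a :: L, M, rfl, rfl, fun h' => absurd h' h⟩

theorem isReduced_ofFn (ξ : Boundary B) (k : ℕ) :
    IsReduced (List.ofFn fun i : Fin k => ξ.1 i) := by
  refine List.isChain_ofFn.2 fun i hi h => ?_
  by_contra hne
  refine ξ.2 i (Prod.ext h.symm ?_)
  change (ξ.1 i).2 ≠ (ξ.1 (i + 1)).2 at hne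
  cases h1 : (ξ.1 i).2 <;> cases h2 : (ξ.1 (i + 1)).2 <;> simp_all

theorem ofFn_add (ξ : Boundary B) (k j : ℕ) : (List.ofFn fun i : Fin (k + j) => ξ.1 i) =
    (List.ofFn fun i : Fin k => ξ.1 i) ++ List.ofFn fun i : Fin j => ξ.1 (k + i) := by
  rw [List.ofFn_add]
  rfl

theorem prefixOf_add (ξ : Boundary B) (k j : ℕ) : prefixOf B ξ (k + j) =
    prefixOf B ξ k * mk (List.ofFn fun i : Fin j => ξ.1 (k + i)) := by
  rw [prefixOf, prefixOf, mul_mk, ofFn_add]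

theorem prefixOf_zero (ξ : Boundary B) : prefixOf B ξ 0 = 1 := rfl

theorem prefixOf_succ (ξ : Boundary B) (k : ℕ) :
    prefixOf B ξ (k + 1) = prefixOf B ξ k * mk [ξ.1 k] := by
  simpa using prefixOf_add ξ k 1

variable [DecidableEq B]

theorem toWord_mk_of_isReduced {L : List (B × Bool)} (h : IsReduced L) : (mk L).toWord = L := by
  rw [toWord_mk, h.reduce_eq]

/-- The direction at the vertex `v` of the tree in which the vertex `u` lies, recorded as the
first letter of `v⁻¹ * u`; it is `none` iff `u = v`. -/
def direction (v u : FreeGroup B) : Option (B × Bool) :=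
  (v⁻¹ * u).toWord.head?

theorem head?_toWord_mul_mk_singleton {u : FreeGroup B} {x : B × Bool} (hu : u ≠ 1)
    (hux : u * mk [x] ≠ 1) : (u * mk [x]).toWord.head? = u.toWord.head? := by
  obtain ⟨L, y, hL⟩ : ∃ L y, u.toWord = L ++ [y] := by
    rcases List.eq_nil_or_concat u.toWord with h | ⟨L, y, h⟩
    · exact absurd (toWord_eq_nil_iff.1 h) hu
    · exact ⟨L, y, by simpa using h⟩
  have hred : IsReduced (L ++ [y]) := hL ▸ isReduced_toWord
  have hmul : u * mk [x] = mk (L ++ [y] ++ [x]) := by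
    rw [← mul_mk, ← hL, mk_toWord]
  by_cases hxy : y.1 = x.1 ∧ y.2 = !x.2
  · have hstep : u * mk [x] = mk L := by
      rw [hmul]
      obtain ⟨x1, x2⟩ := x
      obtain ⟨y1, y2⟩ := y
      dsimp only at hxy
      obtain ⟨rfl, rfl⟩ := hxy
      refine Quot.sound ?_
      simpa using (Red.Step.not_rev (L₁ := L) (L₂ := []) (x := y1) (b := x2))
    have hLred : IsReduced L := hred.infix (List.prefix_append L [y]).isInfix
    rw [hstep, toWord_mk_of_isReduced hLred, hL]
    cases L with
    | nil => exact absurd hstep hux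
    | cons a L => rfl
  · have hred' : IsReduced (L ++ [y] ++ [x]) := by
      refine IsReduced.append_overlap hred ?_ (by simp)
      simp only [List.cons_append, List.nil_append, isReduced_cons_cons, IsReduced.singleton,
        and_true]
      intro h
      by_contra h2
      exact hxy ⟨h, by cases hy : y.2 <;> cases hx : x.2 <;> simp_all⟩
    rw [hmul, toWord_mk_of_isReduced hred', hL]
    cases L <;> rfl

theorem direction_eq_of_adj {v a b : FreeGroup B} (h : Adj B a b) (ha : a ≠ v) (hb : b ≠ v) :
    direction v a = direction v b := by
  obtain ⟨x, rfl⟩ := h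
  have hu : v⁻¹ * a ≠ 1 := fun h => ha (inv_mul_eq_one.1 h).symm
  have hux : v⁻¹ * a * mk [x] ≠ 1 := fun h => hb (inv_mul_eq_one.1 (mul_assoc _ a _ ▸ h)).symm
  rw [direction, direction, ← mul_assoc, head?_toWord_mul_mk_singleton hu hux]

/-- A path spelled by the word `t` that avoids `v` does not change the direction at `v`. -/
theorem direction_mul_mk {v p : FreeGroup B} {t : List (B × Bool)}
    (h : ∀ s, s <+: t → p * mk s ≠ v) : direction v (p * mk t) = direction v p := by
  induction t using List.reverseRecOn with
  | nil => rw [← one_eq_mk, mul_one]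
  | append_singleton t x ih =>
    rw [← ih fun s hs => h s (hs.trans (List.prefix_append _ _))]
    refine (direction_eq_of_adj ⟨x, ?_⟩ (h t (List.prefix_append _ _)) (h _ List.prefix_rfl)).symm
    rw [← mul_mk, mul_assoc]

/-- If `a` and `u` lie in different directions at `m`, then `u` and `m` lie in the same
direction at `a`. -/
theorem direction_eq_of_direction_ne {m a u : FreeGroup B} (ham : a ≠ m)
    (h : direction m a ≠ direction m u) : direction a u = direction a m := by
  have key : ∀ {g k : FreeGroup B}, g ≠ 1 → g.toWord.head? ≠ k.toWord.head? →
      (g⁻¹ * k).toWord.head? = (g⁻¹).toWord.head? := by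
    intro g k hg hgk
    have hred : IsReduced (g⁻¹.toWord ++ k.toWord) := by
      refine List.isChain_append.2 ⟨isReduced_toWord, isReduced_toWord, ?_⟩
      intro x hx y hy hxy
      rw [toWord_inv] at hx
      by_contra hne
      refine hgk (Eq.trans ?_ (Option.mem_def.1 hy).symm)
      have hx' := Option.mem_def.1 hx
      simp only [invRev, List.getLast?_reverse, List.head?_map, Option.map_eq_some_iff] at hx'
      obtain ⟨z, hz, rfl⟩ := hx'
      rw [hz]
      refine congrArg some (Prod.ext hxy ?_)
      cases hz2 : z.2 <;> cases hy2 : y.2 <;> simp_all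
    have hmul : g⁻¹ * k = mk (g⁻¹.toWord ++ k.toWord) := by
      rw [← mul_mk, mk_toWord, mk_toWord]
    rw [hmul, toWord_mk_of_isReduced hred]
    cases hg' : g⁻¹.toWord with
    | nil => exact absurd (inv_eq_one.1 (toWord_eq_nil_iff.1 hg')) hg
    | cons x t => rfl
  have := key (g := m⁻¹ * a) (k := m⁻¹ * u) (fun h => ham (inv_mul_eq_one.1 h).symm) h
  simpa [direction, mul_assoc] using this

theorem direction_eq_of_reflTransGen {v a b : FreeGroup B} {S : Set (FreeGroup B)}
    (hv : v ∉ S) (ha : a ∈ S)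
    (h : Relation.ReflTransGen (fun a b => Adj B a b ∧ b ∈ S) a b) :
    direction v a = direction v b := by
  have : b ∈ S ∧ direction v a = direction v b := by
    induction h with
    | refl => exact ⟨ha, rfl⟩
    | tail _ hbc ih =>
      refine ⟨hbc.2, ih.2.trans (direction_eq_of_adj hbc.1 ?_ ?_)⟩
      · rintro rfl; exact hv ih.1
      · rintro rfl; exact hv hbc.2
  exact this.2

theorem IsSubtree.mem_of_direction_ne {X : Set (FreeGroup B)} (hX : IsSubtree B X)
    {v a b : FreeGroup B} (ha : a ∈ X) (hb : b ∈ X) (h : direction v a ≠ direction v b) :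
    v ∈ X := by
  by_contra hv
  exact h (direction_eq_of_reflTransGen hv ha (hX a ha b hb))

theorem direction_mk_append_ne {x : FreeGroup B} {p L : List (B × Bool)}
    (h : IsReduced (p ++ L)) (hp : p ≠ []) :
    direction (x * mk p) (x * mk (p ++ L)) ≠ direction (x * mk p) x := by
  have h1 : (x * mk p)⁻¹ * (x * mk (p ++ L)) = mk L := by rw [← mul_mk]; group
  have h2 : (x * mk p)⁻¹ * x = mk (invRev p) := by rw [← inv_mk]; group
  have hpr : IsReduced p := h.infix (List.prefix_append p L).isInfix
  have h3 : (mk (invRev p)).toWord = invRev p := by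
    rw [← inv_mk, toWord_inv, toWord_mk_of_isReduced hpr]
  rw [direction, direction, h1, h2, h3,
    toWord_mk_of_isReduced (h.infix (List.suffix_append p L).isInfix)]
  obtain ⟨q, y, rfl⟩ := (List.eq_nil_or_concat p).resolve_left hp
  simp only [List.concat_eq_append, invRev_append] at h ⊢
  intro hL
  have := (List.isChain_append.1 h).2.2 y (by simp) (y.1, !y.2) (by rw [hL]; simp [invRev]) rfl
  simp at this

/-- Any three vertices have a median. -/
theorem exists_median (a b x : FreeGroup B) : ∃ m,
    (m = x ∨ direction m a ≠ direction m x) ∧ (m = x ∨ direction m b ≠ direction m x) ∧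
    (m = a ∨ direction m a ≠ direction m b) := by
  obtain ⟨p, L, M, hL, hM, hLM⟩ := exists_common_prefix (x⁻¹ * a).toWord (x⁻¹ * b).toWord
  have ha : a = x * mk (p ++ L) := by rw [← hL, mk_toWord]; group
  have hb : b = x * mk (p ++ M) := by rw [← hM, mk_toWord]; group
  have hLr : IsReduced (p ++ L) := hL ▸ isReduced_toWord
  have hMr : IsReduced (p ++ M) := hM ▸ isReduced_toWord
  refine ⟨x * mk p, ?_, ?_, ?_⟩
  · rcases eq_or_ne p [] with rfl | hp
    · left; rw [← one_eq_mk, mul_one]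
    · right; rw [ha]; exact direction_mk_append_ne hLr hp
  · rcases eq_or_ne p [] with rfl | hp
    · left; rw [← one_eq_mk, mul_one]
    · right; rw [hb]; exact direction_mk_append_ne hMr hp
  · rcases eq_or_ne L [] with rfl | hL0
    · left; rw [ha, List.append_nil]
    · right
      have h1 : (x * mk p)⁻¹ * a = mk L := by rw [ha, ← mul_mk]; group
      have h2 : (x * mk p)⁻¹ * b = mk M := by rw [hb, ← mul_mk]; group
      rw [direction, direction, h1, h2,
        toWord_mk_of_isReduced (hLr.infix (List.suffix_append p L).isInfix),
        toWord_mk_of_isReduced (hMr.infix (List.suffix_append p M).isInfix)]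
      exact fun h => hL0 (hLM h)

theorem toWord_prefixOf (ξ : Boundary B) (k : ℕ) :
    (prefixOf B ξ k).toWord = List.ofFn fun i : Fin k => ξ.1 i :=
  toWord_mk_of_isReduced (isReduced_ofFn ξ k)

theorem length_toWord_prefixOf (ξ : Boundary B) (k : ℕ) :
    (prefixOf B ξ k).toWord.length = k := by
  rw [toWord_prefixOf, List.length_ofFn]

theorem prefixOf_eq_prefixOf_iff {ξ η : Boundary B} {k : ℕ} :
    prefixOf B ξ k = prefixOf B η k ↔ ∀ i < k, ξ.1 i = η.1 i := by
  rw [← toWord_inj, toWord_prefixOf, toWord_prefixOf, List.ofFn_inj, funext_iff]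
  exact ⟨fun h i hi => h ⟨i, hi⟩, fun h i => h i i.2⟩

theorem prefixOf_ne {ξ : Boundary B} {v : FreeGroup B} {k : ℕ} (h : v.toWord.length ≠ k) :
    prefixOf B ξ k ≠ v := by
  rintro rfl
  exact h (length_toWord_prefixOf ξ k)

/-- The direction at the vertex `v` of the tree in which the boundary point `ξ` lies. -/
def boundaryDirection (v : FreeGroup B) (ξ : Boundary B) : Option (B × Bool) :=
  direction v (prefixOf B ξ (v.toWord.length + 1))

theorem direction_prefixOf_of_forall_ne {v : FreeGroup B} {ξ : Boundary B} {k : ℕ}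
    (h : ∀ n, k ≤ n → prefixOf B ξ n ≠ v) :
    direction v (prefixOf B ξ k) = boundaryDirection v ξ := by
  have key : ∀ {k n : ℕ}, k ≤ n → (∀ n, k ≤ n → prefixOf B ξ n ≠ v) →
      direction v (prefixOf B ξ k) = direction v (prefixOf B ξ n) := by
    intro k n hkn h
    induction n, hkn using Nat.le_induction with
    | base => rfl
    | succ n hn ih =>
      exact ih.trans (direction_eq_of_adj ⟨_, prefixOf_succ ξ n⟩ (h n hn) (h _ (by omega)))
  rw [boundaryDirection, key (le_max_left k (v.toWord.length + 1)) h]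
  exact (key (le_max_right k _) fun n hn => prefixOf_ne (by omega)).symm

theorem direction_prefixOf {v : FreeGroup B} {ξ : Boundary B} {k : ℕ}
    (h : v.toWord.length < k) : direction v (prefixOf B ξ k) = boundaryDirection v ξ :=
  direction_prefixOf_of_forall_ne fun _ hn => prefixOf_ne (by omega)

theorem boundaryDirection_prefixOf (ξ : Boundary B) (k : ℕ) :
    boundaryDirection (prefixOf B ξ k) ξ = some (ξ.1 k) := by
  rw [← direction_prefixOf (k := k + 1) (by rw [length_toWord_prefixOf]; omega), direction,
    prefixOf_succ, inv_mul_cancel_left]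
  rfl

theorem boundaryDirection_eq_direction_one {v : FreeGroup B} {ξ : Boundary B}
    (h : ∀ n, prefixOf B ξ n ≠ v) : boundaryDirection v ξ = direction v 1 := by
  rw [← direction_prefixOf_of_forall_ne (k := 0) fun n _ => h n, prefixOf_zero]

theorem boundaryDirection_prefixOf_ne {ξ η : Boundary B} {k : ℕ}
    (h : ∃ i ≤ k, ξ.1 i ≠ η.1 i) : boundaryDirection (prefixOf B ξ k) ξ ≠
      boundaryDirection (prefixOf B ξ k) η := by
  obtain ⟨i, hik, hi⟩ := h
  by_cases heq : prefixOf B ξ k = prefixOf B η k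
  · obtain rfl : i = k := by
      by_contra hne
      exact hi (prefixOf_eq_prefixOf_iff.1 heq i (by omega))
    rw [boundaryDirection_prefixOf, heq, boundaryDirection_prefixOf]
    simpa using hi
  · have hη : ∀ n, prefixOf B η n ≠ prefixOf B ξ k := by
      intro n hn
      have hlen := congrArg (fun g : FreeGroup B => g.toWord.length) hn
      simp only [length_toWord_prefixOf] at hlen
      subst hlen
      exact heq hn.symm
    have hk : (List.ofFn fun i : Fin k => ξ.1 i) ≠ [] := by
      intro hnil
      obtain rfl : k = 0 := by simpa using congrArg List.length hnil
      exact heq rfl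
    rw [boundaryDirection_eq_direction_one hη,
      ← direction_prefixOf (k := k + 1) (by rw [length_toWord_prefixOf]; omega)]
    have hred := isReduced_ofFn ξ (k + 1)
    rw [ofFn_add] at hred
    have := direction_mk_append_ne (x := 1) hred hk
    rwa [← ofFn_add, one_mul, one_mul] at this

theorem mem_lineGeodesic_iff {ξ η : Boundary B} {v : FreeGroup B} :
    v ∈ lineGeodesic B ξ η ↔ boundaryDirection v ξ ≠ boundaryDirection v η := by
  constructor
  · rintro ⟨k, rfl | rfl, h⟩
    · exact boundaryDirection_prefixOf_ne h
    · exact (boundaryDirection_prefixOf_ne (by simpa only [ne_comm] using h)).symm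
  · intro h
    by_cases hp : ∃ k, v = prefixOf B ξ k ∨ v = prefixOf B η k
    · obtain ⟨k, hk⟩ := hp
      refine ⟨k, hk, ?_⟩
      by_contra! hagree
      have heq : prefixOf B ξ k = prefixOf B η k :=
        prefixOf_eq_prefixOf_iff.2 fun i hi => hagree i hi.le
      have hv : v = prefixOf B ξ k := hk.elim id fun h => h.trans heq.symm
      apply h
      rw [hv, boundaryDirection_prefixOf, heq, boundaryDirection_prefixOf, hagree k le_rfl]
    · push Not at hp
      exact absurd ((boundaryDirection_eq_direction_one fun n => (hp n).1.symm).trans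
        (boundaryDirection_eq_direction_one fun n => (hp n).2.symm).symm) h

theorem boundaryDirection_eq_of_direction_ne {a m : FreeGroup B} {ξ : Boundary B} (ham : a ≠ m)
    (h : direction m a ≠ boundaryDirection m ξ) : boundaryDirection a ξ = direction a m := by
  have hk : a.toWord.length < a.toWord.length + m.toWord.length + 1 := by omega
  have hk' : m.toWord.length < a.toWord.length + m.toWord.length + 1 := by omega
  rw [← direction_prefixOf hk]
  rw [← direction_prefixOf hk'] at h
  exact direction_eq_of_direction_ne ham h

/-- Geodesics of lines are convex. -/
theorem mem_lineGeodesic_of_between {ξ η : Boundary B} {a b m : FreeGroup B}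
    (ha : a ∈ lineGeodesic B ξ η) (hb : b ∈ lineGeodesic B ξ η)
    (hm : m = a ∨ direction m a ≠ direction m b) : m ∈ lineGeodesic B ξ η := by
  rcases eq_or_ne a m with rfl | ham
  · exact ha
  rcases eq_or_ne b m with rfl | hbm
  · exact hb
  have hab := hm.resolve_left ham.symm
  rw [mem_lineGeodesic_iff] at *
  intro hξη
  have key : ∀ c, c ≠ m → direction m c ≠ boundaryDirection m ξ →
      boundaryDirection c ξ = boundaryDirection c η := fun c hc h =>
    (boundaryDirection_eq_of_direction_ne hc h).trans
      (boundaryDirection_eq_of_direction_ne hc (hξη ▸ h)).symm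
  by_cases h : direction m a = boundaryDirection m ξ
  · exact hb (key b hbm fun h' => hab (h.trans h'.symm))
  · exact ha (key a ham h)

/-- The Helly property for two subtrees and the geodesic of a line. -/
theorem PassesThrough.inter {ξ η : Boundary B} {X₁ X₂ : Set (FreeGroup B)}
    (hX₁ : IsSubtree B X₁) (hX₂ : IsSubtree B X₂) (hne : (X₁ ∩ X₂).Nonempty)
    (h₁ : PassesThrough B ξ η X₁) (h₂ : PassesThrough B ξ η X₂) :
    PassesThrough B ξ η (X₁ ∩ X₂) := by
  obtain ⟨a, ha, hag⟩ := h₁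
  obtain ⟨b, hb, hbg⟩ := h₂
  obtain ⟨x, hx₁, hx₂⟩ := hne
  obtain ⟨m, hma, hmb, hmab⟩ := exists_median a b x
  refine ⟨m, ⟨?_, ?_⟩, mem_lineGeodesic_of_between hag hbg hmab⟩
  · exact hma.elim (fun h => h ▸ hx₁) fun h => hX₁.mem_of_direction_ne ha hx₁ h
  · exact hmb.elim (fun h => h ▸ hx₂) fun h => hX₂.mem_of_direction_ne hb hx₂ h

theorem boundaryDirection_eq_of_mem_boundaryOf {Y C : Set (FreeGroup B)}
    (hC : IsComponentOf B Y C) {ξ ξ' : Boundary B} (hξ : ξ ∈ boundaryOf B C)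
    (hξ' : ξ' ∈ boundaryOf B C) {y : FreeGroup B} (hy : y ∈ Y) :
    boundaryDirection y ξ = boundaryDirection y ξ' := by
  obtain ⟨v, hv, rfl⟩ := hC
  have key : ∀ ζ : Boundary B, ζ ∈ boundaryOf B
      {u | Relation.ReflTransGen (fun a b => Adj B a b ∧ a ∉ Y ∧ b ∉ Y) v u} →
      boundaryDirection y ζ = direction y v := by
    rintro ζ ⟨m, hm⟩
    rw [← direction_prefixOf (k := m + y.toWord.length + 1) (by omega)]
    have hpath : Relation.ReflTransGen (fun a b => Adj B a b ∧ b ∈ Yᶜ) v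
        (prefixOf B ζ (m + y.toWord.length + 1)) :=
      Relation.ReflTransGen.mono (fun _ _ h => ⟨h.1, h.2.2⟩) _ _
        (hm (m + y.toWord.length + 1) (by omega))
    exact (direction_eq_of_reflTransGen (S := Yᶜ) (fun h => h hy) hv hpath).symm
  rw [key ξ hξ, key ξ' hξ']

theorem direction_eq_boundaryDirection_of_isPrefix {v u : FreeGroup B} {ξ : Boundary B}
    (h : (List.ofFn fun i : Fin (v.toWord.length + 1) => ξ.1 i) <+: u.toWord) :
    direction v u = boundaryDirection v ξ := by
  obtain ⟨t, ht⟩ := h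
  have hu : u = prefixOf B ξ (v.toWord.length + 1) * mk t := by
    rw [prefixOf, mul_mk, ht, mk_toWord]
  rw [boundaryDirection, hu]
  refine direction_mul_mk fun s hs hv => ?_
  rw [prefixOf, mul_mk] at hv
  have hred : IsReduced ((List.ofFn fun i : Fin (v.toWord.length + 1) => ξ.1 i) ++ s) := by
    refine (isReduced_toWord (x := u)).infix (List.IsPrefix.isInfix ?_)
    rw [← ht]
    exact (List.prefix_append_right_inj _).2 hs
  have hlen := congrArg (fun g : FreeGroup B => g.toWord.length) hv
  simp only [toWord_mk_of_isReduced hred, List.length_append, List.length_ofFn] at hlen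
  omega

/-- The geodesic joining the limits of `g * u ^ k` and `g * u⁻¹ ^ k` stays near the coset
`g⟨u⟩`. -/
theorem exists_zpow_near_of_mem_lineGeodesic {g u v : FreeGroup B} {ξ η : Boundary B}
    (hξ : TendstoBoundary B (fun k => g * u ^ k) ξ)
    (hη : TendstoBoundary B (fun k => g * u⁻¹ ^ k) η) (hv : v ∈ lineGeodesic B ξ η) :
    ∃ a : ℤ, (v⁻¹ * (g * u ^ a)).norm ≤ u.norm := by
  by_contra! hfar
  have hstep : ∀ a : ℤ, direction v (g * u ^ (a + 1)) = direction v (g * u ^ a) := by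
    intro a
    have hu : g * u ^ (a + 1) = g * u ^ a * mk u.toWord := by
      rw [mk_toWord, zpow_add_one, mul_assoc]
    rw [hu]
    refine direction_mul_mk fun s hs hsv => (hfar a).not_ge ?_
    have hinv : v⁻¹ * (g * u ^ a) = (mk s)⁻¹ := by rw [← hsv]; group
    rw [hinv, norm_inv_eq]
    exact norm_mk_le.trans hs.length_le
  have hconst : ∀ a : ℤ, direction v (g * u ^ a) = direction v (g * u ^ (0 : ℤ)) := by
    intro a
    induction a using Int.induction_on with
    | zero => rfl
    | succ n ih => rw [hstep, ih]
    | pred n ih => rw [← ih, ← hstep, sub_add_cancel]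
  obtain ⟨K, hK⟩ := hξ (v.toWord.length + 1)
  obtain ⟨K', hK'⟩ := hη (v.toWord.length + 1)
  rw [mem_lineGeodesic_iff,
    ← direction_eq_boundaryDirection_of_isPrefix (hK K le_rfl),
    ← direction_eq_boundaryDirection_of_isPrefix (hK' K' le_rfl)] at hv
  apply hv
  have h1 := hconst K
  have h2 := hconst (-K')
  rw [zpow_natCast] at h1
  rw [zpow_neg, zpow_natCast, ← inv_pow] at h2
  exact h1.trans h2.symm

theorem TendstoBoundary.eq_of_zpow_translate {g u : FreeGroup B} {c : ℤ} {ξ ξ' : Boundary B}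
    (hξ : TendstoBoundary B (fun k => g * u ^ k) ξ)
    (hξ' : TendstoBoundary B (fun k => g * u ^ c * u ^ k) ξ') : ξ = ξ' := by
  refine Subtype.ext (funext fun m => ?_)
  obtain ⟨K, hK⟩ := hξ (m + 1)
  obtain ⟨K', hK'⟩ := hξ' (m + 1)
  have h1 := hK (K + K' + c.toNat) (by omega)
  have h2 := hK' (K + K' + (-c).toNat) (by omega)
  have hpow : g * u ^ c * u ^ (K + K' + (-c).toNat) = g * u ^ (K + K' + c.toNat) := by
    rw [mul_assoc, ← zpow_natCast, ← zpow_natCast, ← zpow_add]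
    congr 2
    push_cast
    omega
  dsimp only at h1 h2
  rw [hpow] at h2
  have heq := (List.prefix_of_prefix_length_le h1 h2 (by simp)).eq_of_length (by simp)
  exact congrFun (List.ofFn_injective heq) ⟨m, Nat.lt_succ_self m⟩

theorem IsLine.exists_tendsto {r : ℕ} {w : Fin r → FreeGroup B} {ξ η : Boundary B}
    (h : IsLine B w ξ η) : ∃ (g u : FreeGroup B) (i : Fin r), (u = w i ∨ u = (w i)⁻¹) ∧
      TendstoBoundary B (fun k => g * u ^ k) ξ ∧ TendstoBoundary B (fun k => g * u⁻¹ ^ k) η := by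
  obtain ⟨g, i, ⟨h1, h2⟩ | ⟨h1, h2⟩⟩ := h
  · exact ⟨g, w i, i, Or.inl rfl, h1, h2⟩
  · exact ⟨g, (w i)⁻¹, i, Or.inr rfl, h2, by simpa using h1⟩

theorem finite_norm_le [Finite B] (K : ℕ) : {g : FreeGroup B | g.norm ≤ K}.Finite :=
  (List.finite_length_le (B × Bool) K).preimage toWord_injective.injOn

/-- Two lines whose geodesics share sufficiently many vertices have the same endpoints. -/
theorem exists_bound_common_vertices [Finite B] {r : ℕ} {w : Fin r → FreeGroup B}
    (hmal : Malnormal B w) : ∃ N : ℕ, ∀ ξ η ξ' η' : Boundary B, IsLine B w ξ η →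
      IsLine B w ξ' η' → ∀ v : Fin (N + 1) → FreeGroup B, Function.Injective v →
      (∀ j, v j ∈ lineGeodesic B ξ η) → (∀ j, v j ∈ lineGeodesic B ξ' η') →
      (ξ = ξ' ∧ η = η') ∨ (ξ = η' ∧ η = ξ') := by
  set K := ∑ i, (w i).norm
  have hle : ∀ (u : FreeGroup B) (i : Fin r), (u = w i ∨ u = (w i)⁻¹) → u.norm ≤ K := by
    intro u i hu
    have hi : (w i).norm ≤ K :=
      Finset.single_le_sum (f := fun i => (w i).norm) (fun _ _ => Nat.zero_le _)
        (Finset.mem_univ i)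
    rcases hu with rfl | rfl
    · exact hi
    · rwa [norm_inv_eq]
  have hzp : ∀ (u : FreeGroup B) (i : Fin r), (u = w i ∨ u = (w i)⁻¹) → ∀ n : ℤ,
      u ^ n ∈ Subgroup.zpowers (w i) := by
    intro u i hu n
    refine Subgroup.zpow_mem _ ?_ n
    rcases hu with rfl | rfl
    · exact Subgroup.mem_zpowers _
    · exact inv_mem (Subgroup.mem_zpowers _)
  set S : Finset (FreeGroup B) := (finite_norm_le (B := B) K).toFinset with hS
  refine ⟨(S ×ˢ S).card, fun ξ η ξ' η' hl hl' v hinj hv hv' => ?_⟩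
  obtain ⟨g, u, i, hu, hξ, hη⟩ := hl.exists_tendsto
  obtain ⟨g', u', i', hu', hξ', hη'⟩ := hl'.exists_tendsto
  choose a ha using fun j => exists_zpow_near_of_mem_lineGeodesic hξ hη (hv j)
  choose a' ha' using fun j => exists_zpow_near_of_mem_lineGeodesic hξ' hη' (hv' j)
  obtain ⟨j, -, k, -, hjk, heq⟩ := Finset.exists_ne_map_eq_of_card_lt_of_maps_to
    (s := (Finset.univ : Finset (Fin ((S ×ˢ S).card + 1)))) (t := S ×ˢ S)
    (f := fun j => ((v j)⁻¹ * (g * u ^ a j), (v j)⁻¹ * (g' * u' ^ a' j)))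
    (by simp) (fun j _ => by
      simpa [hS] using ⟨(ha j).trans (hle u i hu), (ha' j).trans (hle u' i' hu')⟩)
  obtain ⟨h1, h2⟩ := Prod.ext_iff.1 heq
  have conj : ∀ {p q x y : FreeGroup B} {b c : ℤ}, p⁻¹ * (x * y ^ b) = q⁻¹ * (x * y ^ c) →
      q * p⁻¹ = x * y ^ (c - b) * x⁻¹ := by
    intro p q x y b c h
    rw [eq_mul_inv_of_mul_eq h, zpow_sub]
    group
  have hd := conj h1
  have hd' := conj h2
  have hne : v k * (v j)⁻¹ ≠ 1 := fun h => hjk (hinj (mul_inv_eq_one.1 h)).symm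
  obtain ⟨rfl, hc⟩ := hmal (g'⁻¹ * g) i i' ⟨u ^ (a k - a j), hzp u i hu _, by
    intro h
    rw [hd, h, mul_one, mul_inv_cancel] at hne
    exact hne rfl, by
    have : g'⁻¹ * g * u ^ (a k - a j) * (g'⁻¹ * g)⁻¹ = u' ^ (a' k - a' j) := by
      have h := hd.symm.trans hd'
      calc _ = g'⁻¹ * (g * u ^ (a k - a j) * g⁻¹) * g' := by group
        _ = _ := by rw [h]; group
    rw [this]
    exact hzp u' i' hu' _⟩
  obtain ⟨c, hc⟩ := Subgroup.mem_zpowers_iff.1 hc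
  have hg : g = g' * w i ^ c := by rw [hc, mul_inv_cancel_left]
  have hg' : g = g' * (w i)⁻¹ ^ (-c) := by rw [hg, inv_zpow', neg_neg]
  have same : ∀ {ζ ζ' : Boundary B} {s : FreeGroup B}, (s = w i ∨ s = (w i)⁻¹) →
      TendstoBoundary B (fun k => g * s ^ k) ζ → TendstoBoundary B (fun k => g' * s ^ k) ζ' →
      ζ = ζ' := by
    rintro ζ ζ' s (rfl | rfl) h h'
    · rw [hg] at h
      exact (h'.eq_of_zpow_translate h).symm
    · rw [hg'] at h
      exact (h'.eq_of_zpow_translate h).symm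
  have hinv : u⁻¹ = w i ∨ u⁻¹ = (w i)⁻¹ := by
    rcases hu with rfl | rfl <;> simp
  by_cases huu : u' = u
  · subst huu
    exact Or.inl ⟨same hu hξ hξ', same hinv hη hη'⟩
  · obtain rfl : u' = u⁻¹ := by
      rcases hu with rfl | rfl <;> rcases hu' with h | h
      · exact absurd h huu
      · exact h
      · rw [h, inv_inv]
      · exact absurd h huu
    rw [inv_inv] at hη'
    exact Or.inr ⟨same hu hξ hη', same hinv hη hξ'⟩

theorem exists_injective_mem_lineGeodesic {ξ η : Boundary B} {z : FreeGroup B}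
    (hz : z ∈ lineGeodesic B ξ η) (N : ℕ) : ∃ v : Fin (N + 1) → FreeGroup B,
      Function.Injective v ∧ ∀ j, v j ∈ lineGeodesic B ξ η ∧ (z⁻¹ * v j).toWord.length ≤ N := by
  obtain ⟨k, hk, i, hik, hi⟩ := hz
  obtain ⟨ζ, hζ, rfl⟩ : ∃ ζ, (ζ = ξ ∨ ζ = η) ∧ z = prefixOf B ζ k := by
    rcases hk with h | h
    · exact ⟨ξ, Or.inl rfl, h⟩
    · exact ⟨η, Or.inr rfl, h⟩
  refine ⟨fun j => prefixOf B ζ (k + j), fun j j' h => ?_,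
    fun j => ⟨⟨k + j, ?_, i, by omega, hi⟩, ?_⟩⟩
  · have hlen := congrArg (fun g : FreeGroup B => g.toWord.length) h
    simp only [length_toWord_prefixOf] at hlen
    exact Fin.ext (by omega)
  · rcases hζ with rfl | rfl
    · exact Or.inl rfl
    · exact Or.inr rfl
  · dsimp only
    rw [prefixOf_add, inv_mul_cancel_left]
    refine (norm_mk_le (L₁ := List.ofFn fun i : Fin j => ζ.1 (k + i))).trans ?_
    rw [List.length_ofFn]
    omega

theorem subset_ballAbout (X : Set (FreeGroup B)) (R : ℕ) : X ⊆ ballAbout B X R :=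
  fun x hx => ⟨x, hx, by simp⟩

end DecompPaper

/-- Lemma `intersections2`: there is `D₀`, depending only on `B`
and the words `w i`, such that whenever `f ∈ C¹` is supported on finite nonempty
subtrees `X₁` and `X₂` of `T` with `X₁ ∩ X₂ ≠ ∅`, it is supported on the ball of
radius `D₀` about `X₁ ∩ X₂`. -/
theorem first_cochain_supported_near_intersection
    (B : Type) [Fintype B] [DecidableEq B] (hB : 2 ≤ Fintype.card B)
    (r : ℕ) (w : Fin r → FreeGroup B) (hw : ∀ i, w i ≠ 1) (hmal : Malnormal B w) :
    ∃ D₀ : ℕ, ∀ f : Boundary B → Boundary B → ℤ, Antisym B w f →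
      ∀ X₁ X₂ : Set (FreeGroup B),
        X₁.Finite → X₁.Nonempty → IsSubtree B X₁ →
        X₂.Finite → X₂.Nonempty → IsSubtree B X₂ →
        SupportedOn1 B w f X₁ → SupportedOn1 B w f X₂ →
        (X₁ ∩ X₂).Nonempty →
        SupportedOn1 B w f (ballAbout B (X₁ ∩ X₂) D₀) := by
  obtain ⟨N, hN⟩ := exists_bound_common_vertices hmal
  refine ⟨N, fun f _ X₁ X₂ _ _ hX₁ _ _ hX₂ hf₁ hf₂ hne => ?_⟩
  have hpass : ∀ ξ η, IsLine B w ξ η → ¬PassesThrough B ξ η (X₁ ∩ X₂) → f ξ η = 0 := by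
    intro ξ η hl hnot
    by_contra hf
    refine hnot (PassesThrough.inter hX₁ hX₂ hne ?_ ?_)
    · exact not_not.1 fun h => hf (hf₁.1 ξ η hl h)
    · exact not_not.1 fun h => hf (hf₂.1 ξ η hl h)
  refine ⟨fun ξ η hl hnot => hpass ξ η hl ?_, ?_⟩
  · rintro ⟨x, hx, hxl⟩
    exact hnot ⟨x, subset_ballAbout _ N hx, hxl⟩
  · intro C C' hC hC' _ ξ ξ' η η' hl hl' hξ hξ' hη hη'
    have hgeo : ∀ y ∈ ballAbout B (X₁ ∩ X₂) N,
        (y ∈ lineGeodesic B ξ η ↔ y ∈ lineGeodesic B ξ' η') := by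
      intro y hy
      rw [mem_lineGeodesic_iff, mem_lineGeodesic_iff,
        boundaryDirection_eq_of_mem_boundaryOf hC hξ hξ' hy,
        boundaryDirection_eq_of_mem_boundaryOf hC' hη hη' hy]
    by_cases hp : PassesThrough B ξ η (X₁ ∩ X₂)
    · obtain ⟨z, hz, hzl⟩ := hp
      obtain ⟨v, hinj, hv⟩ := exists_injective_mem_lineGeodesic hzl N
      rcases hN ξ η ξ' η' hl hl' v hinj (fun j => (hv j).1)
        (fun j => (hgeo _ ⟨z, hz, (hv j).2⟩).1 (hv j).1) with ⟨rfl, rfl⟩ | ⟨rfl, rfl⟩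
      · rfl
      · exact absurd (boundaryDirection_eq_of_mem_boundaryOf hC hξ hξ' (subset_ballAbout _ N hz))
          (mem_lineGeodesic_iff.1 hzl)
    · rw [hpass ξ η hl hp, hpass ξ' η' hl']
      rintro ⟨z, hz, hzl⟩
      exact hp ⟨z, hz, (hgeo z (subset_ballAbout _ N hz)).2 hzl⟩
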